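/- Soundness of the sequencing rule: for any commands C and C' and SL propositions P, Q, R, if {P} C {Q} and {Q} C' {R} hold, then {P} C;C' {R} holds. -/

import Mathlib

open scoped Classical

noncomputable section

namespace QSL

/-! ## Resources -/

/-- Vectors over the Hilbert space with orthonormal basis indexed by `Q → {0,1}`. -/
def Vec {Qubit : Type} (Q : Finset Qubit) : Type := ({ q // q ∈ Q } → Bool) → ℂ

/-- A quantum state: a finite set of qubits together with a vector over them. -/
def QState (Qubit : Type) : Type := Σ Q : Finset Qubit, Vec Q

/-- A store: a partial function from variables to values. -/
def Store (Var Val : Type) : Type := Var → Option Val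

/-- A resource: a quantum state together with a store. -/
def Res (Qubit Var Val : Type) : Type := QState Qubit × Store Var Val

variable {Qubit Var Val : Type}

/-- Tensor product of vectors over disjoint qubit sets. -/
def tensorVec {Q Q' : Finset Qubit} (v : Vec Q) (w : Vec Q') : Vec (Q ∪ Q') := fun f =>
  v (fun q => f ⟨q.1, Finset.mem_union_left _ q.2⟩) *
  w (fun q => f ⟨q.1, Finset.mem_union_right _ q.2⟩)

/-- Transport of a vector along an equality of qubit sets. -/
def castVec {Q Q' : Finset Qubit} (h : Q = Q') (v : Vec Q) : Vec Q' := h ▸ v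

/-- The empty quantum state with scalar 1. -/
def unitQ : QState Qubit := ⟨(∅ : Finset Qubit), fun _ => 1⟩

/-- The unit resource: empty qubit set with scalar 1 and the empty store. -/
def unitRes : Res Qubit Var Val := (unitQ, fun _ => none)

/-- Partial product of resources: defined iff the qubit sets are disjoint and
the store domains are disjoint; takes the union of qubit sets, tensor product of
vectors, and union of stores. -/
def rmul (a b : Res Qubit Var Val) : Option (Res Qubit Var Val) :=
  if h : Disjoint a.1.1 b.1.1 ∧ ∀ x, a.2 x = none ∨ b.2 x = none then
    some (⟨a.1.1 ∪ b.1.1, tensorVec a.1.2 b.1.2⟩, fun x => a.2 x <|> b.2 x)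
  else none

/-- Partial sum of resources: defined iff the two resources have the same
qubit set and the same store; adds the vectors. -/
def radd (a b : Res Qubit Var Val) : Option (Res Qubit Var Val) :=
  if h : a.1.1 = b.1.1 ∧ a.2 = b.2 then
    some (⟨b.1.1, fun f => castVec h.1 a.1.2 f + b.1.2 f⟩, b.2)
  else none

/-- Incompatibility of resources: some variable lies in both store domains and
the stores disagree on it. -/
def incompat (a b : Res Qubit Var Val) : Prop :=
  ∃ x u u', a.2 x = some u ∧ b.2 x = some u' ∧ u ≠ u'

/-! ## Multisets (possibly infinite, as families up to bijective reindexing) -/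

/-- An indexed family representing a multiset. -/
structure PreMSet (A : Type) : Type 1 where
  idx : Type
  val : idx → A

/-- Equivalence of indexed families by bijective reindexing. -/
def msetEquiv {A : Type} (f g : PreMSet A) : Prop :=
  ∃ e : f.idx ≃ g.idx, ∀ i, f.val i = g.val (e i)

theorem msetEquiv_refl {A : Type} (f : PreMSet A) : msetEquiv f f :=
  ⟨Equiv.refl _, fun _ => rfl⟩

theorem msetEquiv_symm {A : Type} {f g : PreMSet A} : msetEquiv f g → msetEquiv g f
  | ⟨e, h⟩ => ⟨e.symm, fun i => by rw [h (e.symm i), Equiv.apply_symm_apply]⟩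

theorem msetEquiv_trans {A : Type} {f g k : PreMSet A} :
    msetEquiv f g → msetEquiv g k → msetEquiv f k
  | ⟨e, h⟩, ⟨e', h'⟩ => ⟨e.trans e', fun i => (h i).trans (h' (e i))⟩

instance msetSetoid (A : Type) : Setoid (PreMSet A) :=
  ⟨msetEquiv, ⟨msetEquiv_refl, msetEquiv_symm, msetEquiv_trans⟩⟩

/-- Multisets over `A`: families up to bijective reindexing. -/
def MSet (A : Type) : Type 1 := Quotient (msetSetoid A)

def MSet.mk {A : Type} (I : Type) (f : I → A) : MSet A :=
  Quotient.mk (msetSetoid A) ⟨I, f⟩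

/-- A canonical representative family of a multiset. -/
def MSet.out {A : Type} (m : MSet A) : PreMSet A := Quotient.out m

/-- `a` is an occurrence of the multiset `m`. -/
def MSet.MemM {A : Type} (a : A) (m : MSet A) : Prop := ∃ i, m.out.val i = a

def MSet.map {A B : Type} (f : A → B) (m : MSet A) : MSet B :=
  MSet.mk m.out.idx (fun i => f (m.out.val i))

/-- Sum (disjoint union) of two multisets. -/
def MSet.uplus {A : Type} (m m' : MSet A) : MSet A :=
  MSet.mk (m.out.idx ⊕ m'.out.idx) (Sum.elim m.out.val m'.out.val)

/-- Indexed sum (disjoint union) of a family of multisets. -/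
def MSet.biguplus {A : Type} (I : Type) (f : I → MSet A) : MSet A :=
  MSet.mk (Σ x : I, (f x).out.idx) (fun p => (f p.1).out.val p.2)


/-- Partial product of multisets of resources: an occurrence `a·b` for every
pair of occurrences, defined iff all these resource products are defined. -/
def mprodM (m m' : MSet (Res Qubit Var Val)) : Option (MSet (Res Qubit Var Val)) :=
  if h : ∀ (i : m.out.idx) (j : m'.out.idx), (rmul (m.out.val i) (m'.out.val j)).isSome then
    some (MSet.mk (m.out.idx × m'.out.idx)
      (fun p => (rmul (m.out.val p.1) (m'.out.val p.2)).get (h p.1 p.2)))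
  else none

/-- Sum of the two projections of a multiset of pairs of resources (the
multiset of pairs plays the role of a multiset bijection between its two
projections): defined iff all the componentwise resource sums are defined. -/
def msumr (r : MSet (Res Qubit Var Val × Res Qubit Var Val)) :
    Option (MSet (Res Qubit Var Val)) :=
  if h : ∀ i, (radd (r.out.val i).1 (r.out.val i).2).isSome then
    some (MSet.mk r.out.idx (fun i => (radd (r.out.val i).1 (r.out.val i).2).get (h i)))
  else none

/-! ## SL propositions -/

/-- An SL proposition: a set of multisets of resources. -/
abbrev SLProp (Qubit Var Val : Type) : Type 1 := Set (MSet (Res Qubit Var Val))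


/-- Entailment of SL propositions: set inclusion. -/
def entails (P Q : SLProp Qubit Var Val) : Prop := P ⊆ Q

/-- Separating conjunction. -/
def star (P Q : SLProp Qubit Var Val) : SLProp Qubit Var Val :=
  { m | ∃ mp ∈ P, ∃ mq ∈ Q, mprodM mp mq = some m }

/-- Sum of SL propositions: all defined sums `m +_r m'` over `m ∈ P`, `m' ∈ Q`
and multiset bijections `r` between `m` and `m'`. -/
def propSum (P Q : SLProp Qubit Var Val) : SLProp Qubit Var Val :=
  { m | ∃ r : MSet (Res Qubit Var Val × Res Qubit Var Val),
      MSet.map Prod.fst r ∈ P ∧ MSet.map Prod.snd r ∈ Q ∧ msumr r = some m }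

/-- Indexed bare mixing. -/
def bigMix (I : Type) (P : I → SLProp Qubit Var Val) : SLProp Qubit Var Val :=
  { m | ∃ f : I → MSet (Res Qubit Var Val), (∀ x, f x ∈ P x) ∧ m = MSet.biguplus I f }

/-- Binary bare mixing, the case of `bigMix` over a two-element index set. -/
def binMix (P Q : SLProp Qubit Var Val) : SLProp Qubit Var Val :=
  bigMix Bool (fun b => if b then Q else P)

/-- Precision: any two multisets in `P` are equal. -/
def precise (P : SLProp Qubit Var Val) : Prop := ∀ m ∈ P, ∀ m' ∈ P, m = m'

/-- Non-emptiness of behaviours: every multiset in `P` is nonempty. -/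
def nonnb (P : SLProp Qubit Var Val) : Prop := ∀ m ∈ P, Nonempty (MSet.out m).idx

/-- Unambiguity: any two occurrences at distinct indices are incompatible. -/
def unambig (P : SLProp Qubit Var Val) : Prop :=
  ∀ m ∈ P, ∀ i j : (MSet.out m).idx, i ≠ j → incompat (m.out.val i) (m.out.val j)

/-- Incompatibility of SL propositions: every occurrence of every `m ∈ P` is
incompatible with every occurrence of every `m' ∈ Q`. -/
def propIncompat (P Q : SLProp Qubit Var Val) : Prop :=
  ∀ m ∈ P, ∀ m' ∈ Q, ∀ (i : (MSet.out m).idx) (j : (MSet.out m').idx),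
    incompat (m.out.val i) (m'.out.val j)

/-- The singleton proposition of the one-element multiset of a resource. -/
def singletonProp (a : Res Qubit Var Val) : SLProp Qubit Var Val :=
  { m | m = MSet.mk PUnit (fun _ => a) }

/-- The points-to proposition `ι ↦ v`: empty quantum state (scalar 1) and the
store mapping only `ι` to `v`. -/
def varPoints (ι : Var) (v : Val) : SLProp Qubit Var Val :=
  singletonProp (unitQ, fun y => if y = ι then some v else none)

/-- Tagged mixing over an index set of values. -/
def taggedMix (ι : Var) (I : Set Val) (P : Val → SLProp Qubit Var Val) :
    SLProp Qubit Var Val :=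
  bigMix I (fun x => star (varPoints ι x.1) (P x.1))

/-! ## The programming language (values are natural numbers) -/

/-- Pure expressions: constants, variables, operations applied to subexpressions. -/
inductive Expr (Var : Type) : Type
  | const : ℕ → Expr Var
  | evar : Var → Expr Var
  | op : (n : ℕ) → ((Fin n → ℕ) → ℕ) → (Fin n → Expr Var) → Expr Var

/-- Evaluation of a pure expression in a store; undefined on variables outside
the store's domain. -/
def Expr.eval {Var : Type} (S : Store Var ℕ) : Expr Var → Option ℕ
  | .const n => some n
  | .evar x => S x
  | .op n f es =>
      if h : ∀ i, (Expr.eval S (es i)).isSome then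
        some (f (fun i => (Expr.eval S (es i)).get (h i)))
      else none

/-- A unitary operator on `n` qubits, as a matrix with orthonormal columns. -/
structure UnitaryOp (n : ℕ) : Type where
  mat : (Fin n → Bool) → (Fin n → Bool) → ℂ
  unitary : ∀ a b, (∑ c : Fin n → Bool, (starRingEnd ℂ) (mat c a) * mat c b) =
    if a = b then 1 else 0

/-- A measurement: a finite family of linear operators `M⁽ⁱ⁾` on `n` qubits
with `Σᵢ (M⁽ⁱ⁾)† M⁽ⁱ⁾ = I`. -/
structure MeasOp (k n : ℕ) : Type where
  ops : Fin k → (Fin n → Bool) → (Fin n → Bool) → ℂ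
  complete : ∀ a b,
    (∑ i : Fin k, ∑ c : Fin n → Bool, (starRingEnd ℂ) (ops i c a) * ops i c b) =
      if a = b then 1 else 0


/-- Apply an operator (given by its matrix) to the designated qubits of a
quantum state; defined iff the designated qubits are distinct and all present. -/
def applyOp {n : ℕ} (mat : (Fin n → Bool) → (Fin n → Bool) → ℂ) (qs : Fin n → Qubit)
    (ψ : QState Qubit) : Option (QState Qubit) :=
  if h : Function.Injective qs ∧ ∀ i, qs i ∈ ψ.1 then
    some ⟨ψ.1, fun g => ∑ b : Fin n → Bool,
      mat (fun i => g ⟨qs i, h.2 i⟩) b *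
      ψ.2 (fun q => if h' : ∃ i, qs i = q.1 then b h'.choose else g q)⟩
  else none

/-- Commands of the language. -/
inductive Cmd (Qubit Var : Type) : Type
  | skip
  | seq (c c' : Cmd Qubit Var)
  | ite (e : Expr Var) (c1 c0 : Cmd Qubit Var)
  | whileC (e : Expr Var) (c : Cmd Qubit Var)
  | assign (x : Var) (e : Expr Var)
  | unitary (n : ℕ) (U : UnitaryOp n) (qs : Fin n → Qubit)
  | measure (x : Var) (k n : ℕ) (M : MeasOp k n) (qs : Fin n → Qubit)

/-! ## Behaviour trees (represented as partial labelling functions on paths) -/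

/-- Node labels of behaviour trees. -/
inductive BLabel (Qubit Var : Type) : Type
  | branch (k : ℕ)
  | leaf (a : Res Qubit Var ℕ)
  | nil

/-- Behaviour trees, represented by their partial labelling function on paths. -/
def BTree (Qubit Var : Type) : Type := List ℕ → Option (BLabel Qubit Var)

/-- The tree `Nil`. -/
def nilTree : BTree Qubit Var := fun p => if p = [] then some BLabel.nil else none

/-- The tree `Leaf a`. -/
def leafTree (a : Res Qubit Var ℕ) : BTree Qubit Var :=
  fun p => if p = [] then some (BLabel.leaf a) else none

/-- The tree `Branch` with `k` children. -/
def branchTree (k : ℕ) (child : Fin k → BTree Qubit Var) : BTree Qubit Var := fun p =>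
  match p with
  | [] => some (BLabel.branch k)
  | i :: p' => if h : i < k then child ⟨i, h⟩ p' else none

/-- Iterated child access `t.ī`. -/
def BTree.access (t : BTree Qubit Var) (is : List ℕ) : BTree Qubit Var :=
  fun p => t (is ++ p)

/-- Branching of partially-defined children: defined iff all children are. -/
def branchOpt (k : ℕ) (f : Fin k → Option (BTree Qubit Var)) : Option (BTree Qubit Var) :=
  if h : ∀ i, (f i).isSome then some (branchTree k (fun i => (f i).get (h i))) else none

/-- Store update. -/
def updStore (S : Store Var ℕ) (x : Var) (v : ℕ) : Store Var ℕ :=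
  fun y => if y = x then some v else S y

/-! ## Denotational semantics -/

/-- The `n`-th approximation of the denotational semantics, rendering
computations unfinished after `n` unfolding steps as `Nil`. -/
def semN : ℕ → List (Cmd Qubit Var) → QState Qubit → Store Var ℕ → Option (BTree Qubit Var)
  | 0, _, _, _ => some nilTree
  | _ + 1, [], ψ, S => some (leafTree (ψ, S))
  | n + 1, Cmd.skip :: cs, ψ, S => semN n cs ψ S
  | n + 1, Cmd.seq c c' :: cs, ψ, S => semN n (c :: c' :: cs) ψ S
  | n + 1, Cmd.ite e c1 c0 :: cs, ψ, S =>
      match Expr.eval S e with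
      | some 1 => semN n (c1 :: cs) ψ S
      | some 0 => semN n (c0 :: cs) ψ S
      | _ => none
  | n + 1, Cmd.whileC e c :: cs, ψ, S =>
      semN n (Cmd.ite e (Cmd.seq c (Cmd.whileC e c)) Cmd.skip :: cs) ψ S
  | n + 1, Cmd.assign x e :: cs, ψ, S =>
      match S x, Expr.eval S e with
      | some _, some v => semN n cs ψ (updStore S x v)
      | _, _ => none
  | n + 1, Cmd.unitary nq U qs :: cs, ψ, S =>
      match applyOp U.mat qs ψ with
      | some ψ' => semN n cs ψ' S
      | none => none
  | n + 1, Cmd.measure x k nq M qs :: cs, ψ, S =>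
      match S x with
      | some _ =>
          branchOpt k (fun i =>
            (applyOp (M.ops i) qs ψ).bind (fun ψ' => semN n cs ψ' (updStore S x i.1)))
      | none => none

/-- The denotational semantics: defined iff all approximations are, and then
the limit (least upper bound) of the ω-chain of approximations. -/
def sem (cs : List (Cmd Qubit Var)) (ψ : QState Qubit) (S : Store Var ℕ) :
    Option (BTree Qubit Var) :=
  if h : ∀ n, (semN n cs ψ S).isSome then
    some (fun p =>
      if h1 : ∃ n l, ((semN n cs ψ S).get (h n)) p = some l ∧ l ≠ BLabel.nil then
        some h1.choose_spec.choose
      else if ∃ n, ((semN n cs ψ S).get (h n)) p = some BLabel.nil then some BLabel.nil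
      else none)
  else none

/-! ## Logical semantics and Hoare triples -/

/-- The multiset of leaves of a behaviour tree, indexed by the branch paths. -/
def Leaves (t : BTree Qubit Var) : MSet (Res Qubit Var ℕ) :=
  MSet.mk { p : List ℕ // ∃ a, t p = some (BLabel.leaf a) } (fun p => p.2.choose)

/-- Logical semantics of a command on a multiset of resources. -/
def msem (C : Cmd Qubit Var) (m : MSet (Res Qubit Var ℕ)) :
    Option (MSet (Res Qubit Var ℕ)) :=
  if h : ∀ i, (sem [C] (m.out.val i).1 (m.out.val i).2).isSome then
    some (MSet.biguplus m.out.idx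
      (fun i => Leaves ((sem [C] (m.out.val i).1 (m.out.val i).2).get (h i))))
  else none

/-- The Hoare triple `{P} C {Q}`. -/
def hoare (P : SLProp Qubit Var ℕ) (C : Cmd Qubit Var) (Q : SLProp Qubit Var ℕ) : Prop :=
  ∀ m ∈ P, ∃ m', msem C m = some m' ∧ m' ∈ Q

/-- Logical semantics of a pure expression: extend the store of every outcome
with the binding of the distinguished variable `ret` to the value of `e`. -/
def esem (ret : Var) (e : Expr Var) (m : MSet (Res Qubit Var ℕ)) :
    Option (MSet (Res Qubit Var ℕ)) :=
  if h : ∀ i, (Expr.eval (m.out.val i).2 e).isSome then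
    some (MSet.mk m.out.idx (fun i =>
      ((m.out.val i).1,
        updStore (m.out.val i).2 ret ((Expr.eval (m.out.val i).2 e).get (h i)))))
  else none

/-- The Hoare triple `{P} e {Q}` for a pure expression. -/
def ehoare (ret : Var) (P : SLProp Qubit Var ℕ) (e : Expr Var)
    (Q : SLProp Qubit Var ℕ) : Prop :=
  ∀ m ∈ P, ∃ m', esem ret e m = some m' ∧ m' ∈ Q

/-- The return token `rtok v`. -/
def rtok (ret : Var) (v : ℕ) : SLProp Qubit Var ℕ := varPoints ret v

/-! ## Auxiliary operational semantics -/

/-- Result of a single head step. -/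
inductive HOut (Qubit Var : Type) : Type
  | fail
  | go (ds : List (Cmd Qubit Var)) (a : Res Qubit Var ℕ)
  | br (k : ℕ) (f : Fin k → Option (Res Qubit Var ℕ))

/-- Head step. -/
def hstep : Cmd Qubit Var → Res Qubit Var ℕ → HOut Qubit Var
  | Cmd.skip, a => .go [] a
  | Cmd.seq c c', a => .go [c, c'] a
  | Cmd.ite e c1 c0, a =>
      match Expr.eval a.2 e with
      | some 1 => .go [c1] a
      | some 0 => .go [c0] a
      | _ => .fail
  | Cmd.whileC e c, a => .go [Cmd.ite e (Cmd.seq c (Cmd.whileC e c)) Cmd.skip] a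
  | Cmd.assign x e, a =>
      match a.2 x, Expr.eval a.2 e with
      | some _, some v => .go [] (a.1, updStore a.2 x v)
      | _, _ => .fail
  | Cmd.unitary _ U qs, a =>
      match applyOp U.mat qs a.1 with
      | some ψ' => .go [] (ψ', a.2)
      | none => .fail
  | Cmd.measure x k _ M qs, a =>
      match a.2 x with
      | some _ => .br k (fun i => (applyOp (M.ops i) qs a.1).map
          (fun ψ' => (ψ', updStore a.2 x i.1)))
      | none => .fail

theorem semN_cons (n : ℕ) (c : Cmd Qubit Var) (cs : List (Cmd Qubit Var))
    (a : Res Qubit Var ℕ) :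
    semN (n + 1) (c :: cs) a.1 a.2 =
      match hstep c a with
      | .fail => none
      | .go ds b => semN n (ds ++ cs) b.1 b.2
      | .br k f => branchOpt k (fun i => (f i).bind (fun b => semN n cs b.1 b.2)) := by
  cases c with
  | skip => rfl
  | seq c c' => rfl
  | ite e c1 c0 =>
    simp only [semN, hstep]
    rcases Expr.eval a.2 e with _ | _ | _ | v <;> rfl
  | whileC e c => rfl
  | assign x e =>
    simp only [semN, hstep]
    rcases a.2 x with _ | w
    · rfl
    · rcases Expr.eval a.2 e with _ | v <;> rfl
  | unitary n U qs =>
    simp only [semN, hstep]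
    rcases applyOp U.mat qs a.1 with _ | v <;> rfl
  | measure x k n M qs =>
    simp only [semN, hstep]
    rcases a.2 x with _ | w
    · rfl
    · refine congrArg (branchOpt k) (funext fun i => ?_)
      beta_reduce
      rcases applyOp (M.ops i) qs a.1 with _ | v <;> rfl

/-- Terminating runs along a path. -/
inductive Run : List (Cmd Qubit Var) → Res Qubit Var ℕ → List ℕ → Res Qubit Var ℕ → Prop
  | nil (a) : Run [] a [] a
  | go {c cs a ds a' p b} : hstep c a = .go ds a' → Run (ds ++ cs) a' p b →
      Run (c :: cs) a p b
  | br {c cs a k f a' p b} (i : Fin k) : hstep c a = .br k f → f i = some a' →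
      Run cs a' p b → Run (c :: cs) a (i.1 :: p) b

/-- Failing runs. -/
inductive Err : List (Cmd Qubit Var) → Res Qubit Var ℕ → Prop
  | fail {c cs a} : hstep c a = .fail → Err (c :: cs) a
  | go {c cs a ds a'} : hstep c a = .go ds a' → Err (ds ++ cs) a' → Err (c :: cs) a
  | brn {c cs a k f} (i : Fin k) : hstep c a = .br k f → f i = none → Err (c :: cs) a
  | brs {c cs a k f a'} (i : Fin k) : hstep c a = .br k f → f i = some a' →
      Err cs a' → Err (c :: cs) a

theorem Run.split {L : List (Cmd Qubit Var)} {a p b} (h : Run L a p b) :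
    ∀ cs cs', L = cs ++ cs' →
      ∃ p1 p2 c, p = p1 ++ p2 ∧ Run cs a p1 c ∧ Run cs' c p2 b := by
  induction h with
  | nil a =>
    intro cs cs' h
    obtain ⟨rfl, rfl⟩ := List.append_eq_nil_iff.1 h.symm
    exact ⟨[], [], a, rfl, .nil a, .nil a⟩
  | @go c cs0 a ds a' p b h1 h2 ih =>
    intro cs cs' h
    cases cs with
    | nil =>
      simp only [List.nil_append] at h
      subst h
      exact ⟨[], p, a, rfl, .nil a, .go h1 h2⟩
    | cons d cs =>
      simp only [List.cons_append, List.cons.injEq] at h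
      obtain ⟨rfl, rfl⟩ := h
      obtain ⟨p1, p2, c', e, r1, r2⟩ := ih (ds ++ cs) cs' (by simp)
      exact ⟨p1, p2, c', e, .go h1 r1, r2⟩
  | @br c cs0 a k f a' p b i h1 h2 h3 ih =>
    intro cs cs' h
    cases cs with
    | nil =>
      simp only [List.nil_append] at h
      subst h
      exact ⟨[], i.1 :: p, a, rfl, .nil a, .br i h1 h2 h3⟩
    | cons d cs =>
      simp only [List.cons_append, List.cons.injEq] at h
      obtain ⟨rfl, rfl⟩ := h
      obtain ⟨p1, p2, c', e, r1, r2⟩ := ih cs cs' rfl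
      exact ⟨i.1 :: p1, p2, c', by simp [e], .br i h1 h2 r1, r2⟩

theorem Run.append {cs : List (Cmd Qubit Var)} {a p1 c} (h : Run cs a p1 c) {cs' p2 b}
    (h' : Run cs' c p2 b) : Run (cs ++ cs') a (p1 ++ p2) b := by
  induction h with
  | nil a => exact h'
  | go h1 h2 ih =>
    have := ih h'
    rw [List.append_assoc] at this
    exact .go h1 this
  | br i h1 h2 h3 ih => exact .br i h1 h2 (ih h')

theorem Err.split {L : List (Cmd Qubit Var)} {a} (h : Err L a) :
    ∀ cs cs', L = cs ++ cs' → Err cs a ∨ ∃ p c, Run cs a p c ∧ Err cs' c := by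
  induction h with
  | @fail c cs0 a h1 =>
    intro cs cs' h
    cases cs with
    | nil =>
      simp only [List.nil_append] at h
      subst h
      exact .inr ⟨[], a, .nil a, .fail h1⟩
    | cons d cs =>
      simp only [List.cons_append, List.cons.injEq] at h
      obtain ⟨rfl, rfl⟩ := h
      exact .inl (.fail h1)
  | @go c cs0 a ds a' h1 h2 ih =>
    intro cs cs' h
    cases cs with
    | nil =>
      simp only [List.nil_append] at h
      subst h
      exact .inr ⟨[], a, .nil a, .go h1 h2⟩
    | cons d cs =>
      simp only [List.cons_append, List.cons.injEq] at h
      obtain ⟨rfl, rfl⟩ := h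
      rcases ih (ds ++ cs) cs' (by simp) with r | ⟨p, c, r, r'⟩
      · exact .inl (.go h1 r)
      · exact .inr ⟨p, c, .go h1 r, r'⟩
  | @brn c cs0 a k f i h1 h2 =>
    intro cs cs' h
    cases cs with
    | nil =>
      simp only [List.nil_append] at h
      subst h
      exact .inr ⟨[], a, .nil a, .brn i h1 h2⟩
    | cons d cs =>
      simp only [List.cons_append, List.cons.injEq] at h
      obtain ⟨rfl, rfl⟩ := h
      exact .inl (.brn i h1 h2)
  | @brs c cs0 a k f a' i h1 h2 h3 ih =>
    intro cs cs' h
    cases cs with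
    | nil =>
      simp only [List.nil_append] at h
      subst h
      exact .inr ⟨[], a, .nil a, .brs i h1 h2 h3⟩
    | cons d cs =>
      simp only [List.cons_append, List.cons.injEq] at h
      obtain ⟨rfl, rfl⟩ := h
      rcases ih cs cs' rfl with r | ⟨p, c, r, r'⟩
      · exact .inl (.brs i h1 h2 r)
      · exact .inr ⟨i.1 :: p, c, .br i h1 h2 r, r'⟩

theorem Run.det {cs : List (Cmd Qubit Var)} {a p c} (h : Run cs a p c) :
    ∀ {p' c' q q'}, Run cs a p' c' → p ++ q = p' ++ q' → p = p' ∧ c = c' := by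
  induction h with
  | nil a =>
    intro p' c' q q' h e
    cases h
    exact ⟨rfl, rfl⟩
  | go h1 h2 ih =>
    intro p' c' q q' h e
    cases h with
    | go g1 g2 =>
      rw [h1] at g1
      cases g1
      exact ih g2 e
    | br i g1 g2 g3 => rw [h1] at g1; cases g1
  | br i h1 h2 h3 ih =>
    intro p' c' q q' h e
    cases h with
    | go g1 g2 => rw [h1] at g1; cases g1
    | br j g1 g2 g3 =>
      rw [h1] at g1
      cases g1
      simp only [List.cons_append, List.cons.injEq] at e
      obtain ⟨e1, e2⟩ := e
      have e1 := Fin.ext e1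
      subst e1
      rw [h2] at g2
      cases g2
      obtain ⟨rfl, rfl⟩ := ih g3 e2
      exact ⟨rfl, rfl⟩

theorem branchOpt_none {k : ℕ} {f : Fin k → Option (BTree Qubit Var)} :
    branchOpt k f = none ↔ ∃ i, f i = none := by
  unfold branchOpt
  split_ifs with h
  · simp only [reduceCtorEq, false_iff, not_exists]
    intro i hi
    have := h i
    simp [hi] at this
  · push Not at h
    simpa using h

theorem branchOpt_some {k : ℕ} {f : Fin k → Option (BTree Qubit Var)} {t} :
    branchOpt k f = some t ↔ ∃ g, (∀ i, f i = some (g i)) ∧ t = branchTree k g := by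
  unfold branchOpt
  split_ifs with h
  · constructor
    · intro e
      cases e
      exact ⟨_, fun i => by simp, rfl⟩
    · rintro ⟨g, hg, rfl⟩
      simp [hg]
  · simp only [reduceCtorEq, false_iff, not_exists]
    rintro g ⟨hg, -⟩
    exact h fun i => by simp [hg]

theorem semN_none {n : ℕ} : ∀ {cs : List (Cmd Qubit Var)} {a : Res Qubit Var ℕ},
    semN n cs a.1 a.2 = none → Err cs a := by
  induction n with
  | zero => intro cs a h; simp [semN] at h
  | succ n ih =>
    intro cs a h
    cases cs with
    | nil => simp [semN] at h
    | cons c cs =>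
      rw [semN_cons] at h
      rcases e : hstep c a with _ | ⟨ds, b⟩ | ⟨k, f⟩
      · exact .fail e
      · rw [e] at h
        exact .go e (ih h)
      · rw [e] at h
        obtain ⟨i, hi⟩ := branchOpt_none.1 h
        rcases e' : f i with _ | b
        · exact .brn i e e'
        · rw [e'] at hi
          exact .brs i e e' (ih hi)

theorem Err.semN_none {cs : List (Cmd Qubit Var)} {a : Res Qubit Var ℕ} (h : Err cs a) :
    ∃ n, semN n cs a.1 a.2 = none := by
  induction h with
  | fail h => exact ⟨1, by rw [semN_cons, h]⟩
  | go h1 h2 ih =>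
    obtain ⟨n, hn⟩ := ih
    exact ⟨n + 1, by rw [semN_cons, h1]; exact hn⟩
  | brn i h1 h2 =>
    exact ⟨1, by rw [semN_cons, h1]; exact branchOpt_none.2 ⟨i, by rw [h2]; rfl⟩⟩
  | brs i h1 h2 h3 ih =>
    obtain ⟨n, hn⟩ := ih
    exact ⟨n + 1, by rw [semN_cons, h1]; exact branchOpt_none.2 ⟨i, by rw [h2]; exact hn⟩⟩

theorem semN_leaf {n : ℕ} : ∀ {cs : List (Cmd Qubit Var)} {a : Res Qubit Var ℕ} {t p b},
    semN n cs a.1 a.2 = some t → t p = some (BLabel.leaf b) → Run cs a p b := by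
  induction n with
  | zero =>
    intro cs a t p b h hp
    simp only [semN, Option.some.injEq] at h
    subst h
    unfold nilTree at hp
    split_ifs at hp
    cases hp
  | succ n ih =>
    intro cs a t p b h hp
    cases cs with
    | nil =>
      simp only [semN, Option.some.injEq] at h
      subst h
      unfold leafTree at hp
      split_ifs at hp with e
      cases hp
      subst e
      exact .nil a
    | cons c cs =>
      rw [semN_cons] at h
      rcases e : hstep c a with _ | ⟨ds, b'⟩ | ⟨k, f⟩
      · rw [e] at h; cases h
      · rw [e] at h
        exact .go e (ih h hp)
      · rw [e] at h
        obtain ⟨g, hg, rfl⟩ := branchOpt_some.1 h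
        cases p with
        | nil => cases hp
        | cons i p =>
          simp only [branchTree] at hp
          split_ifs at hp with hi
          have hgi := hg ⟨i, hi⟩
          rcases e' : f ⟨i, hi⟩ with _ | b'
          · rw [e'] at hgi; cases hgi
          · rw [e'] at hgi
            exact Run.br ⟨i, hi⟩ e e' (ih hgi hp)

theorem Run.semN_leaf {cs : List (Cmd Qubit Var)} {a : Res Qubit Var ℕ} {p b}
    (h : Run cs a p b) :
    ∃ n, ∀ t, semN n cs a.1 a.2 = some t → t p = some (BLabel.leaf b) := by
  induction h with
  | nil a =>
    refine ⟨1, fun t h => ?_⟩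
    simp only [semN, Option.some.injEq] at h
    subst h
    simp [leafTree]
    rfl
  | go h1 h2 ih =>
    obtain ⟨n, hn⟩ := ih
    refine ⟨n + 1, fun t h => ?_⟩
    rw [semN_cons, h1] at h
    exact hn t h
  | br i h1 h2 h3 ih =>
    obtain ⟨n, hn⟩ := ih
    refine ⟨n + 1, fun t h => ?_⟩
    rw [semN_cons, h1] at h
    obtain ⟨g, hg, rfl⟩ := branchOpt_some.1 h
    have hgi := hg i
    rw [h2] at hgi
    simp only [branchTree, i.2, dite_true]
    exact hn _ hgi

theorem semN_mono {n : ℕ} : ∀ {m : ℕ} {cs : List (Cmd Qubit Var)} {a : Res Qubit Var ℕ}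
    {t t' p l}, n ≤ m → semN n cs a.1 a.2 = some t → semN m cs a.1 a.2 = some t' →
    t p = some l → l ≠ BLabel.nil → t' p = some l := by
  induction n with
  | zero =>
    intro m cs a t t' p l _ h h' hp hl
    simp only [semN, Option.some.injEq] at h
    subst h
    unfold nilTree at hp
    split_ifs at hp
    cases hp
    exact absurd rfl hl
  | succ n ih =>
    intro m cs a t t' p l hm h h' hp hl
    obtain ⟨m, rfl⟩ : ∃ m', m = m' + 1 := ⟨m - 1, by omega⟩
    have hm : n ≤ m := by omega
    cases cs with
    | nil =>
      simp only [semN, Option.some.injEq] at h h'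
      subst h
      subst h'
      exact hp
    | cons c cs =>
      rw [semN_cons] at h h'
      rcases e : hstep c a with _ | ⟨ds, b'⟩ | ⟨k, f⟩
      · rw [e] at h; cases h
      · rw [e] at h h'
        exact ih hm h h' hp hl
      · rw [e] at h h'
        obtain ⟨g, hg, rfl⟩ := branchOpt_some.1 h
        obtain ⟨g', hg', rfl⟩ := branchOpt_some.1 h'
        cases p with
        | nil => exact hp
        | cons i p =>
          simp only [branchTree] at hp ⊢
          split_ifs at hp ⊢ with hi
          have hgi := hg ⟨i, hi⟩
          have hgi' := hg' ⟨i, hi⟩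
          rcases e' : f ⟨i, hi⟩ with _ | b'
          · rw [e'] at hgi; cases hgi
          · rw [e'] at hgi hgi'
            exact ih hm hgi hgi' hp hl

theorem semN_uniq {n m : ℕ} {cs : List (Cmd Qubit Var)} {a : Res Qubit Var ℕ}
    {t t' p l l'} (h : semN n cs a.1 a.2 = some t) (h' : semN m cs a.1 a.2 = some t')
    (hp : t p = some l) (hl : l ≠ BLabel.nil) (hp' : t' p = some l')
    (hl' : l' ≠ BLabel.nil) : l = l' := by
  rcases le_total n m with hm | hm
  · have := semN_mono hm h h' hp hl
    rw [hp'] at this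
    exact (Option.some.inj this).symm
  · have := semN_mono hm h' h hp' hl'
    rw [hp] at this
    exact (Option.some.inj this)

theorem sem_isSome {cs : List (Cmd Qubit Var)} {a : Res Qubit Var ℕ} :
    (sem cs a.1 a.2).isSome ↔ ¬ Err cs a := by
  unfold sem
  split_ifs with h
  · refine ⟨fun _ he => ?_, fun _ => rfl⟩
    obtain ⟨n, hn⟩ := he.semN_none
    have := h n
    simp [hn] at this
  · refine ⟨fun h0 => absurd h0 Bool.false_ne_true, fun h0 => absurd (fun n => ?_) h⟩
    rcases e : semN n cs a.1 a.2 with _ | t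
    · exact absurd (semN_none e) h0
    · rfl

theorem sem_leaf {cs : List (Cmd Qubit Var)} {a : Res Qubit Var ℕ} {t p b}
    (ht : sem cs a.1 a.2 = some t) : t p = some (BLabel.leaf b) ↔ Run cs a p b := by
  unfold sem at ht
  split_ifs at ht with h
  cases ht
  have key : ∀ n, semN n cs a.1 a.2 = some ((semN n cs a.1 a.2).get (h n)) := fun n => by simp
  beta_reduce
  constructor
  · intro hp
    split_ifs at hp with h1 h2
    · have hs := h1.choose_spec.choose_spec
      rw [Option.some.inj hp] at hs
      exact semN_leaf (key _) hs.1
    · cases hp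
  · intro r
    obtain ⟨n, hn⟩ := r.semN_leaf
    have hn := hn _ (key n)
    have h1 : ∃ n l, ((semN n cs a.1 a.2).get (h n)) p = some l ∧ l ≠ BLabel.nil :=
      ⟨n, _, hn, by simp⟩
    have hs := h1.choose_spec.choose_spec
    rw [dif_pos h1]
    congr 1
    exact semN_uniq (key _) (key n) hs.1 hs.2 hn (by simp)

/-! ## Multiset level -/

theorem MSet.mk_eq {A I J : Type} {f : I → A} {g : J → A} (e : I ≃ J)
    (h : ∀ i, f i = g (e i)) : MSet.mk I f = MSet.mk J g :=
  Quotient.sound ⟨e, h⟩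

theorem MSet.out_mk {A I : Type} (f : I → A) :
    ∃ e : (MSet.mk I f).out.idx ≃ I, ∀ i, (MSet.mk I f).out.val i = f (e i) :=
  Quotient.exact (Quotient.out_eq (MSet.mk I f))

theorem MSet.biguplus_mk {A I : Type} (J : I → Type) (g : ∀ i, J i → A) :
    MSet.biguplus I (fun i => MSet.mk (J i) (g i)) =
      MSet.mk (Σ i, J i) (fun x => g x.1 x.2) := by
  choose e he using fun i => MSet.out_mk (g i)
  exact MSet.mk_eq (Equiv.sigmaCongrRight e) (fun x => he x.1 x.2)

/-- Index type of outcomes. -/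
def RunIdx (cs : List (Cmd Qubit Var)) (a : Res Qubit Var ℕ) : Type :=
  { x : List ℕ × Res Qubit Var ℕ // Run cs a x.1 x.2 }

theorem Leaves_eq {cs : List (Cmd Qubit Var)} {a : Res Qubit Var ℕ} {t}
    (ht : sem cs a.1 a.2 = some t) :
    Leaves t = MSet.mk (RunIdx cs a) (fun x => x.1.2) := by
  refine Eq.symm (MSet.mk_eq (Equiv.ofBijective
    (fun x : RunIdx cs a => ⟨x.1.1, x.1.2, (sem_leaf ht).2 x.2⟩) ⟨?_, ?_⟩) ?_)
  · rintro ⟨⟨p, b⟩, r⟩ ⟨⟨p', b'⟩, r'⟩ e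
    simp only [Subtype.mk.injEq] at e
    subst e
    obtain ⟨-, e⟩ := Run.det r r' (q := []) rfl
    exact Subtype.ext (Prod.ext rfl e)
  · rintro ⟨p, b, hb⟩
    exact ⟨⟨(p, b), (sem_leaf ht).1 hb⟩, rfl⟩
  · rintro ⟨⟨p, b⟩, r⟩
    have hx : ∃ a, t p = some (BLabel.leaf a) := ⟨b, (sem_leaf ht).2 r⟩
    have := (sem_leaf ht).1 hx.choose_spec
    exact (Run.det r this (q := []) rfl).2

theorem msem_mk {C : Cmd Qubit Var} {I : Type} {f : I → Res Qubit Var ℕ}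
    (h : ∀ i, ¬ Err [C] (f i)) :
    msem C (MSet.mk I f) = some (MSet.mk (Σ i, RunIdx [C] (f i)) (fun x => x.2.1.2)) := by
  obtain ⟨e, he⟩ := MSet.out_mk f
  unfold msem
  rw [dif_pos (fun i => sem_isSome.2 (by rw [he]; exact h _))]
  congr 1
  have : ∀ i (hi : (sem [C] ((MSet.mk I f).out.val i).1 ((MSet.mk I f).out.val i).2).isSome),
      Leaves ((sem [C] ((MSet.mk I f).out.val i).1 ((MSet.mk I f).out.val i).2).get hi)
      = MSet.mk (RunIdx [C] (f (e i))) (fun x => x.1.2) := by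
    intro i hi
    rw [← he]
    exact Leaves_eq (by simp)
  simp only [this]
  rw [MSet.biguplus_mk (fun i => RunIdx [C] (f (e i))) (fun i x => x.1.2)]
  exact MSet.mk_eq (Equiv.sigmaCongrLeft (β := fun i => RunIdx [C] (f i)) e) (fun x => rfl)

theorem msem_not_err {C : Cmd Qubit Var} {I : Type} {f : I → Res Qubit Var ℕ} {m}
    (h : msem C (MSet.mk I f) = some m) (i : I) : ¬ Err [C] (f i) := by
  obtain ⟨e, he⟩ := MSet.out_mk f
  unfold msem at h
  split_ifs at h with h0
  have := sem_isSome.1 (h0 (e.symm i))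
  rwa [he, Equiv.apply_symm_apply] at this

theorem Run_seq {C C' : Cmd Qubit Var} {a p b} :
    Run [Cmd.seq C C'] a p b ↔ Run [C, C'] a p b := by
  constructor
  · intro h
    cases h with
    | go h1 h2 => cases h1; exact h2
    | br i h1 => cases h1
  · exact fun h => .go rfl h

theorem Err_seq {C C' : Cmd Qubit Var} {a} (h : Err [Cmd.seq C C'] a) : Err [C, C'] a := by
  cases h with
  | fail h => cases h
  | go h1 h2 => cases h1; exact h2
  | brn i h => cases h
  | brs i h => cases h

/-- Soundness of the sequencing rule. -/
theorem hoare_seq {Qubit Var : Type} (C C' : Cmd Qubit Var)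
    (P Q R : SLProp Qubit Var ℕ)
    (h : hoare P C Q) (h' : hoare Q C' R) :
    hoare P (Cmd.seq C C') R := by
  intro m hm
  obtain ⟨⟨I, f⟩, rfl⟩ := Quotient.exists_rep m
  change MSet.mk I f ∈ P at hm
  change ∃ m', msem _ (MSet.mk I f) = some m' ∧ _
  obtain ⟨m1, e1, hm1⟩ := h _ hm
  have n1 := msem_not_err e1
  rw [msem_mk n1] at e1
  cases e1
  obtain ⟨m2, e2, hm2⟩ := h' _ hm1
  have n2 := msem_not_err e2
  rw [msem_mk n2] at e2
  cases e2
  have n3 : ∀ i, ¬ Err [Cmd.seq C C'] (f i) := by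
    intro i he
    rcases (Err_seq he).split [C] [C'] rfl with r | ⟨p, c, r, r'⟩
    · exact n1 i r
    · exact n2 ⟨i, ⟨(p, c), r⟩⟩ r'
  refine ⟨_, msem_mk n3, ?_⟩
  convert hm2 using 1
  symm
  refine MSet.mk_eq (Equiv.ofBijective
    (fun x => ⟨x.1.1, ⟨(x.1.2.1.1 ++ x.2.1.1, x.2.1.2),
      Run_seq.2 (Run.append x.1.2.2 x.2.2)⟩⟩) ⟨?_, ?_⟩) (fun x => rfl)
  · rintro ⟨⟨i, ⟨⟨p, c⟩, r⟩⟩, ⟨⟨p2, b⟩, r2⟩⟩ ⟨⟨i', ⟨⟨p', c'⟩, r'⟩⟩, ⟨⟨p2', b'⟩, r2'⟩⟩ e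
    obtain ⟨rfl, e⟩ := Sigma.mk.inj e
    have ee := congrArg Subtype.val (eq_of_heq e)
    clear e
    have ee1 : p ++ p2 = p' ++ p2' := congrArg Prod.fst ee
    have ee2 : b = b' := congrArg Prod.snd ee
    clear ee
    subst ee2
    obtain ⟨e3, e4⟩ := Run.det r r' ee1
    dsimp only at e3 e4
    subst e3 e4
    obtain rfl := List.append_cancel_left ee1
    rfl
  · rintro ⟨i, ⟨⟨p, b⟩, r⟩⟩
    obtain ⟨p1, p2, c, e, r1, r2⟩ := (Run_seq.1 r).split [C] [C'] rfl
    dsimp only at e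
    subst e
    exact ⟨⟨⟨i, ⟨(p1, c), r1⟩⟩, ⟨(p2, b), r2⟩⟩, rfl⟩
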